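/- arXiv:2110.08683 — 3 statements merged into one kernel-verified Lean document; each statement's English description precedes it below -/
import Mathlib

section
/- The linear map ℝ⁵ → ℝ⁵ sending coefficient vectors (a₀, a₁, a₂, a₃, a₄) to the five cell averages of the polynomial p₃(x,y) = a₀ + a₁x + a₂x² + a₃y + a₄y² over the five unit cells of the cross stencil (the unit squares centered at (0,0), (-1,0), (0,1), (1,0), (0,-1)) is bijective; that is, the five coefficients of the third-order reconstruction polynomial without the xy term are uniquely determined by the five stencil cell averages. -/
open MeasureTheory intervalIntegral

/-- The centers of the five cells of the cross stencil (in scaled unit-cell coordinates):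
cell 1 at (0,0), cell 2 at (-1,0), cell 3 at (0,1), cell 4 at (1,0), cell 5 at (0,-1). -/
def crossCenter : Fin 5 → ℝ × ℝ := ![(0, 0), (-1, 0), (0, 1), (1, 0), (0, -1)]

/-- The map sending coefficients (a₀,…,a₄) of p₃(x,y) = a₀ + a₁x + a₂x² + a₃y + a₄y²
to the five cell averages over the unit cells of the cross stencil. -/
noncomputable def coeffsToAverages (a : Fin 5 → ℝ) : Fin 5 → ℝ := fun i =>
  ∫ y in ((crossCenter i).2 - 1/2)..((crossCenter i).2 + 1/2),
    ∫ x in ((crossCenter i).1 - 1/2)..((crossCenter i).1 + 1/2),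
      (a 0 + a 1 * x + a 2 * x ^ 2 + a 3 * y + a 4 * y ^ 2)

theorem integral_quadratic_unit_interval (b c d m : ℝ) :
    ∫ x in (m - 1/2)..(m + 1/2), (b + c * x + d * x ^ 2) = b + c * m + d * (m ^ 2 + 1/12) := by
  rw [intervalIntegral.integral_add (Continuous.intervalIntegrable (by fun_prop) _ _)
      (Continuous.intervalIntegrable (by fun_prop) _ _),
    intervalIntegral.integral_add (Continuous.intervalIntegrable (by fun_prop) _ _)
      (Continuous.intervalIntegrable (by fun_prop) _ _),
    intervalIntegral.integral_const_mul, intervalIntegral.integral_const_mul,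
    intervalIntegral.integral_const, integral_id, integral_pow, smul_eq_mul]
  push_cast
  ring

theorem coeffsToAverages_apply (a : Fin 5 → ℝ) (i : Fin 5) :
    coeffsToAverages a i = a 0 + a 1 * (crossCenter i).1 + a 2 * ((crossCenter i).1 ^ 2 + 1/12)
      + a 3 * (crossCenter i).2 + a 4 * ((crossCenter i).2 ^ 2 + 1/12) := by
  have inner (y : ℝ) :
      ∫ x in ((crossCenter i).1 - 1/2)..((crossCenter i).1 + 1/2),
        (a 0 + a 1 * x + a 2 * x ^ 2 + a 3 * y + a 4 * y ^ 2) =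
      (a 0 + a 1 * (crossCenter i).1 + a 2 * ((crossCenter i).1 ^ 2 + 1/12))
        + a 3 * y + a 4 * y ^ 2 := by
    calc
      _ = ∫ x in ((crossCenter i).1 - 1/2)..((crossCenter i).1 + 1/2),
          ((a 0 + a 3 * y + a 4 * y ^ 2) + a 1 * x + a 2 * x ^ 2) := by
        congr 1
        ext x
        ring
      _ = _ := by
        rw [integral_quadratic_unit_interval]
        ring
  simp only [coeffsToAverages, inner, integral_quadratic_unit_interval]

/-- The coefficients of the reconstruction polynomial with prescribed cell averages. -/
noncomputable def averagesToCoeffs (v : Fin 5 → ℝ) : Fin 5 → ℝ :=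
  ![v 0 - (v 1 + v 2 + v 3 + v 4 - 4 * v 0) / 24, (v 3 - v 1) / 2, (v 1 + v 3 - 2 * v 0) / 2,
    (v 2 - v 4) / 2, (v 2 + v 4 - 2 * v 0) / 2]

theorem coeffsToAverages_bijective : Function.Bijective coeffsToAverages := by
  refine Function.bijective_iff_has_inverse.mpr ⟨averagesToCoeffs, fun a => ?_, fun v => ?_⟩
  · ext i
    fin_cases i <;> simp [averagesToCoeffs, coeffsToAverages_apply, crossCenter] <;> ring
  · ext i
    fin_cases i <;> simp [averagesToCoeffs, coeffsToAverages_apply, crossCenter] <;> ring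
end

section
/- The doubly cell-averaged one-dimensional squared-exponential kernel admits the closed form: for all ℓ > 0, Δ > 0, and x_m, x_n ∈ ℝ, writing s = (x_n - x_m)/Δ, one has (1/Δ²) ∫_{x_n - Δ/2}^{x_n + Δ/2} ∫_{x_m - Δ/2}^{x_m + Δ/2} exp(-(x - y)²/(2ℓ²)) dx dy = √π·(ℓ/Δ)²·{ ((s+1)/(√2·ℓ/Δ))·erf((s+1)/(√2·ℓ/Δ)) + ((s-1)/(√2·ℓ/Δ))·erf((s-1)/(√2·ℓ/Δ)) + (1/√π)·( exp(-(s+1)²/(2(ℓ/Δ)²)) + exp(-(s-1)²/(2(ℓ/Δ)²)) ) - 2·( (s/(√2·ℓ/Δ))·erf(s/(√2·ℓ/Δ)) + (1/√π)·exp(-s²/(2(ℓ/Δ)²)) ) }. -/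
open MeasureTheory intervalIntegral

/-- The error function erf(z) = (2/√π) ∫₀ᶻ exp(-t²) dt. -/
noncomputable def erf (z : ℝ) : ℝ :=
  (2 / Real.sqrt Real.pi) * ∫ t in (0:ℝ)..z, Real.exp (-t ^ 2)

theorem hasDerivAt_erf (z : ℝ) :
    HasDerivAt erf (2 / Real.sqrt Real.pi * Real.exp (-z ^ 2)) z := by
  have hc : Continuous fun t : ℝ => Real.exp (-t ^ 2) := by fun_prop
  exact (hc.integral_hasStrictDerivAt 0 z).hasDerivAt.const_mul _

theorem continuous_erf : Continuous erf :=
  continuous_iff_continuousAt.2 fun z => (hasDerivAt_erf z).continuousAt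

theorem erf_neg (z : ℝ) : erf (-z) = -erf z := by
  have h := intervalIntegral.integral_comp_neg (a := 0) (b := z) fun t : ℝ => Real.exp (-t ^ 2)
  simp only [neg_sq, neg_zero] at h
  rw [erf, erf, intervalIntegral.integral_symm, ← h, mul_neg]

/-- The antiderivative `z * erf z + exp (-z²) / √π` of the error function. -/
noncomputable def erfPrimitive (z : ℝ) : ℝ :=
  z * erf z + 1 / Real.sqrt Real.pi * Real.exp (-z ^ 2)

theorem hasDerivAt_erfPrimitive (z : ℝ) : HasDerivAt erfPrimitive (erf z) z := by
  have h := ((hasDerivAt_id z).mul (hasDerivAt_erf z)).add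
    ((((hasDerivAt_id z).pow 2).neg.exp).const_mul (1 / Real.sqrt Real.pi))
  refine h.congr_deriv ?_
  simp only [Pi.neg_apply, Pi.pow_apply, id_eq]
  push_cast
  ring

theorem erfPrimitive_neg (z : ℝ) : erfPrimitive (-z) = erfPrimitive z := by
  simp [erfPrimitive, erf_neg]

theorem integral_exp_neg_sq_div {c : ℝ} (hc : c ≠ 0) (a b y : ℝ) :
    ∫ x in a..b, Real.exp (-(x - y) ^ 2 / c ^ 2) =
      c * Real.sqrt Real.pi / 2 * (erf ((b - y) / c) - erf ((a - y) / c)) := by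
  have hpi : Real.sqrt Real.pi ≠ 0 := (Real.sqrt_pos.2 Real.pi_pos).ne'
  rw [intervalIntegral.integral_eq_sub_of_hasDerivAt
    (f := fun x => c * Real.sqrt Real.pi / 2 * erf ((x - y) / c))]
  · ring
  · intro x _
    have h := ((hasDerivAt_erf ((x - y) / c)).comp x
      (((hasDerivAt_id x).sub_const y).div_const c)).const_mul (c * Real.sqrt Real.pi / 2)
    refine h.congr_deriv ?_
    rw [div_pow, neg_div]
    field_simp
  · exact Continuous.intervalIntegrable (by fun_prop) _ _

theorem integral_erf_sub_div {c : ℝ} (hc : c ≠ 0) (a u v : ℝ) :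
    ∫ y in u..v, erf ((a - y) / c) =
      c * (erfPrimitive ((a - u) / c) - erfPrimitive ((a - v) / c)) := by
  rw [intervalIntegral.integral_eq_sub_of_hasDerivAt
    (f := fun y => -c * erfPrimitive ((a - y) / c))]
  · ring
  · intro y _
    have h := ((hasDerivAt_erfPrimitive ((a - y) / c)).comp y
      (((hasDerivAt_id y).const_sub a).div_const c)).const_mul (-c)
    refine h.congr_deriv ?_
    field_simp
  · exact (continuous_erf.comp (by fun_prop)).intervalIntegrable _ _

theorem se_kernel_double_cell_average (ℓ Δ : ℝ) (hℓ : 0 < ℓ) (hΔ : 0 < Δ) (xm xn : ℝ) :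
    (1 / Δ ^ 2) *
        ∫ y in (xn - Δ/2)..(xn + Δ/2), ∫ x in (xm - Δ/2)..(xm + Δ/2),
          Real.exp (-(x - y) ^ 2 / (2 * ℓ ^ 2)) =
      Real.sqrt Real.pi * (ℓ / Δ) ^ 2 *
        ((((xn - xm) / Δ + 1) / (Real.sqrt 2 * ℓ / Δ)) * erf (((xn - xm) / Δ + 1) / (Real.sqrt 2 * ℓ / Δ))
          + (((xn - xm) / Δ - 1) / (Real.sqrt 2 * ℓ / Δ)) * erf (((xn - xm) / Δ - 1) / (Real.sqrt 2 * ℓ / Δ))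
          + (1 / Real.sqrt Real.pi) *
              (Real.exp (-((xn - xm) / Δ + 1) ^ 2 / (2 * (ℓ / Δ) ^ 2))
                + Real.exp (-((xn - xm) / Δ - 1) ^ 2 / (2 * (ℓ / Δ) ^ 2)))
          - 2 * ((((xn - xm) / Δ) / (Real.sqrt 2 * ℓ / Δ)) * erf (((xn - xm) / Δ) / (Real.sqrt 2 * ℓ / Δ))
                  + (1 / Real.sqrt Real.pi) * Real.exp (-((xn - xm) / Δ) ^ 2 / (2 * (ℓ / Δ) ^ 2)))) := by
  set c : ℝ := Real.sqrt 2 * ℓ with hc_def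
  have hc : c ≠ 0 := by positivity
  have hc2 : c ^ 2 = 2 * ℓ ^ 2 := by rw [hc_def, mul_pow, Real.sq_sqrt zero_le_two]
  have hint (a : ℝ) : IntervalIntegrable (fun y => erf ((a - y) / c)) volume
      (xn - Δ / 2) (xn + Δ / 2) :=
    (continuous_erf.comp (by fun_prop)).intervalIntegrable _ _
  have hexp (t : ℝ) : -t ^ 2 / (2 * (ℓ / Δ) ^ 2) = -(t / (c / Δ)) ^ 2 := by
    rw [div_pow t, div_pow c, hc2, div_pow, neg_div, mul_div_assoc]
  simp only [← hc2, integral_exp_neg_sq_div hc, intervalIntegral.integral_const_mul]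
  rw [intervalIntegral.integral_sub (hint _) (hint _), integral_erf_sub_div hc,
    integral_erf_sub_div hc]
  have h1 : (xm + Δ / 2 - (xn - Δ / 2)) / c = -(((xn - xm) / Δ - 1) / (c / Δ)) := by
    field_simp
    ring
  have h2 : (xm + Δ / 2 - (xn + Δ / 2)) / c = -(((xn - xm) / Δ) / (c / Δ)) := by
    field_simp
    ring
  have h3 : (xm - Δ / 2 - (xn - Δ / 2)) / c = -(((xn - xm) / Δ) / (c / Δ)) := by
    field_simp
    ring
  have h4 : (xm - Δ / 2 - (xn + Δ / 2)) / c = -(((xn - xm) / Δ + 1) / (c / Δ)) := by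
    field_simp
    ring
  rw [h1, h2, h3, h4]
  simp only [erfPrimitive_neg]
  simp only [hexp, erfPrimitive]
  have hl : (ℓ / Δ) ^ 2 = c ^ 2 / 2 * (1 / Δ ^ 2) := by
    rw [hc2]
    ring
  rw [hl]
  ring
end

section
/- The second derivative of the one-dimensional cell-averaged squared-exponential kernel with respect to the evaluation point admits the closed form: for all ℓ > 0, Δ > 0, x_m ∈ ℝ, the function T(x_*) = (1/Δ) ∫_{x_m - Δ/2}^{x_m + Δ/2} exp(-(x_* - x)²/(2ℓ²)) dx is twice differentiable in x_*, with T''(x_*) = (1/ℓ²)·( (δ - 1/2)·exp(-(δ - 1/2)²/(2(ℓ/Δ)²)) - (δ + 1/2)·exp(-(δ + 1/2)²/(2(ℓ/Δ)²)) ), where δ = (x_* - x_m)/Δ. -/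
open MeasureTheory intervalIntegral

theorem hasDerivAt_integral_comp_sub {g : ℝ → ℝ} (hg : Continuous g) (a b y : ℝ) :
    HasDerivAt (fun y => ∫ x in a..b, g (y - x)) (g (y - a) - g (y - b)) y := by
  have hG (u : ℝ) : HasDerivAt (fun u => ∫ x in (0 : ℝ)..u, g x) (g u) u :=
    hg.integral_hasStrictDerivAt 0 u |>.hasDerivAt
  have heq : (fun y => ∫ x in a..b, g (y - x)) =
      fun y => (∫ x in (0 : ℝ)..(y - a), g x) - ∫ x in (0 : ℝ)..(y - b), g x := by
    funext y
    rw [integral_comp_sub_left, integral_interval_sub_left] <;>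
      exact hg.intervalIntegrable _ _
  rw [heq]
  exact ((hG (y - a)).comp_sub_const y a).sub ((hG (y - b)).comp_sub_const y b)

theorem hasDerivAt_exp_neg_sq_div (ℓ u : ℝ) :
    HasDerivAt (fun u => Real.exp (-u ^ 2 / (2 * ℓ ^ 2)))
      (-(u / ℓ ^ 2) * Real.exp (-u ^ 2 / (2 * ℓ ^ 2))) u := by
  refine (((hasDerivAt_id' u).fun_pow 2).fun_neg.div_const (2 * ℓ ^ 2)).exp.congr_deriv ?_
  push_cast
  ring

theorem se_kernel_cell_average_second_deriv (ℓ Δ : ℝ) (hℓ : 0 < ℓ) (hΔ : 0 < Δ) (xm : ℝ) :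
    Differentiable ℝ
        (fun x₀ => (1 / Δ) * ∫ x in (xm - Δ/2)..(xm + Δ/2), Real.exp (-(x₀ - x) ^ 2 / (2 * ℓ ^ 2)))
      ∧ ∀ xs : ℝ,
        HasDerivAt
          (deriv (fun x₀ =>
            (1 / Δ) * ∫ x in (xm - Δ/2)..(xm + Δ/2), Real.exp (-(x₀ - x) ^ 2 / (2 * ℓ ^ 2))))
          ((1 / ℓ ^ 2) *
            (((xs - xm) / Δ - 1/2) * Real.exp (-((xs - xm) / Δ - 1/2) ^ 2 / (2 * (ℓ / Δ) ^ 2))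
              - ((xs - xm) / Δ + 1/2) * Real.exp (-((xs - xm) / Δ + 1/2) ^ 2 / (2 * (ℓ / Δ) ^ 2))))
          xs := by
  have hT (x₀ : ℝ) := (hasDerivAt_integral_comp_sub
    (g := fun u => Real.exp (-u ^ 2 / (2 * ℓ ^ 2))) (by fun_prop)
    (xm - Δ / 2) (xm + Δ / 2) x₀).const_mul (1 / Δ)
  refine ⟨fun x₀ => (hT x₀).differentiableAt, fun xs => ?_⟩
  rw [funext fun x₀ => (hT x₀).deriv]
  have hK (c : ℝ) := (hasDerivAt_exp_neg_sq_div ℓ (xs - c)).comp_sub_const xs c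
  have hscale (u : ℝ) : -(u / Δ) ^ 2 / (2 * (ℓ / Δ) ^ 2) = -u ^ 2 / (2 * ℓ ^ 2) := by
    field_simp
  have hminus : (xs - xm) / Δ - 1 / 2 = (xs - (xm + Δ / 2)) / Δ := by
    field_simp
    ring
  have hplus : (xs - xm) / Δ + 1 / 2 = (xs - (xm - Δ / 2)) / Δ := by
    field_simp
    ring
  rw [hminus, hplus, hscale, hscale]
  refine (((hK (xm - Δ / 2)).fun_sub (hK (xm + Δ / 2))).const_mul (1 / Δ)).congr_deriv ?_
  ring
end
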